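/- arXiv:1804.03759 — 4 statements merged into one kernel-verified Lean document; each statement's English description precedes it below -/
import Mathlib

section
/- Let G be a finite connected simple graph that is a ZV-line graph w.r.t. a ZV-ordered partition ⟨Z, V_1, …, V_k⟩, and let F* be the mechanism obtained by applying the definition of F* recursively to G and its subgraphs. Then F* is anonymous, Pareto optimal, and group-manipulation-resistant. -/
/- Common framework: finite connected simple graphs, shortest-path distance,
   profiles as lists of vertices, mechanisms as functions `List α → α`,
   anonymity, Pareto optimality, and group-manipulation-resistance. -/

open Classical

noncomputable section

/-- The ball of radius `r` around `v`. -/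
def ball {α : Type} (G : SimpleGraph α) (v : α) (r : ℕ) : Set α :=
  {u | G.dist v u ≤ r}

/-- Distance from a vertex to a (nonempty) set of vertices. -/
def distToSet {α : Type} (G : SimpleGraph α) (v : α) (Z : Finset α) : ℕ :=
  sInf ((fun z => G.dist v z) '' (Z : Set α))

/-- An agent located at `ℓ` weakly prefers `a` over `b`. -/
def wPref {α : Type} (G : SimpleGraph α) (ℓ a b : α) : Prop := G.dist ℓ a ≤ G.dist ℓ b

/-- An agent located at `ℓ` strictly prefers `a` over `b`. -/
def sPref {α : Type} (G : SimpleGraph α) (ℓ a b : α) : Prop := G.dist ℓ a < G.dist ℓ b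

/-- `u` Pareto dominates `v` w.r.t. the profile `x`. -/
def Dominates {α : Type} (G : SimpleGraph α) (x : List α) (u v : α) : Prop :=
  (∀ a ∈ x, wPref G a u v) ∧ (∃ a ∈ x, sPref G a u v)

/-- The set of Pareto optimal locations for a profile `x`. -/
def PO {α : Type} (G : SimpleGraph α) (x : List α) : Set α :=
  {v | ¬ ∃ u, Dominates G x u v}

/-- A mechanism is anonymous if its outcome is invariant under permutations of ballots. -/
def Anonymous {α : Type} (F : List α → α) : Prop :=
  ∀ x y : List α, x.Perm y → F x = F y

/-- A mechanism is Pareto optimal if its outcome is always Pareto optimal. -/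
def ParetoOptimal {α : Type} (G : SimpleGraph α) (F : List α → α) : Prop :=
  ∀ x : List α, F x ∈ PO G x

/-- The list of ballots `x j` for agents `j` outside the coalition `C`. -/
def profileMinus {α : Type} {n : ℕ} (x : Fin n → α) (C : Finset (Fin n)) : List α :=
  ((List.finRange n).filter (fun i => decide (i ∉ C))).map x

/-- Group-manipulation-resistance where all sincere ballots and all manipulated
ballots are required to lie in the set `S`. -/
def GMRon {α : Type} (G : SimpleGraph α) (S : Set α) (F : List α → α) : Prop :=
  ¬ ∃ (n : ℕ) (x : Fin n → α) (C : Finset (Fin n)) (A : List α),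
      (∀ i, x i ∈ S) ∧ (∀ a ∈ A, a ∈ S) ∧
      (∀ i ∈ C, wPref G (x i) (F (A ++ profileMinus x C)) (F (List.ofFn x))) ∧
      (∃ i ∈ C, sPref G (x i) (F (A ++ profileMinus x C)) (F (List.ofFn x)))

/-- Group-manipulation-resistance: no coalition `C` can, by replacing its ballots
with an arbitrary finite tuple `A` of ballots (misreporting, false-name voting,
or abstaining), obtain an outcome that all its members weakly prefer and at least
one member strictly prefers. -/
def GMR {α : Type} (G : SimpleGraph α) (F : List α → α) : Prop :=
  ¬ ∃ (n : ℕ) (x : Fin n → α) (C : Finset (Fin n)) (A : List α),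
      (∀ i ∈ C, wPref G (x i) (F (A ++ profileMinus x C)) (F (List.ofFn x))) ∧
      (∃ i ∈ C, sPref G (x i) (F (A ++ profileMinus x C)) (F (List.ofFn x)))

/-- `A` is an interval in `Z` (w.r.t. the order injection `ord`): it is a subset
of `Z` that is order-convex within `Z`. -/
def IsIntervalIn {α : Type} (ord : α → ℝ) (Z : Finset α) (A : Set α) : Prop :=
  A ⊆ (Z : Set α) ∧
  ∀ a ∈ A, ∀ b ∈ A, ∀ c ∈ Z, ord a ≤ ord c → ord c ≤ ord b → c ∈ A

/-- A ZV-ordered partition ⟨Z, V₁, …, V_k⟩ of a connected graph `G`, together with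
the order (injection into ℝ) on `Z` and the roots of the `Vᵢ`. -/
structure ZVPartition {α : Type} (G : SimpleGraph α) where
  hconn : G.Connected
  k : ℕ
  Z : Finset α
  Vs : Fin k → Finset α
  ord : α → ℝ
  Z_nonempty : Z.Nonempty
  Vs_nonempty : ∀ i, (Vs i).Nonempty
  ord_inj : Set.InjOn ord (Z : Set α)
  Vs_disjoint : ∀ i j, i ≠ j → Disjoint (Vs i) (Vs j)
  cover : ∀ v : α, v ∈ Z ∨ ∃ i, v ∈ Vs i
  no_drop_Z : ¬ ∀ v : α, ∃ i, v ∈ Vs i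
  no_drop_Vs : ∀ i : Fin k, ¬ ∀ v : α, v ∈ Z ∨ ∃ j, j ≠ i ∧ v ∈ Vs j
  root : Fin k → α
  root_mem : ∀ i, root i ∈ Vs i
  root_min : ∀ i, ∀ u ∈ Vs i, distToSet G (root i) Z ≤ distToSet G u Z
  root_unique : ∀ i, ∀ u ∈ Vs i, (∀ w ∈ Vs i, distToSet G u Z ≤ distToSet G w Z) → u = root i
  separation : ∀ i : Fin k, ∀ u ∈ Vs i, ∀ v : α, v ∉ Vs i →
      ∀ p : G.Walk u v, root i ∈ p.support ∧ ∃ z ∈ Z, z ∈ p.support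

/-- `G` is a ZV-line graph w.r.t. the ZV-ordered partition `P`: balls of radius 1
around Z-vertices meet `Z` in intervals, each induced subgraph on `Vᵢ` is
recursively a ZV-line graph whose Z-set contains the root of `Vᵢ` as its leftmost
element, and balls of radius 1 around the roots meet `Z` in intervals. -/
inductive IsZVLineGraph : {β : Type} → {H : SimpleGraph β} → ZVPartition H → Prop
  | mk {β : Type} {H : SimpleGraph β} (P : ZVPartition H)
      (hb : ∀ z ∈ P.Z, IsIntervalIn P.ord P.Z (ball H z 1 ∩ (P.Z : Set β)))
      (Q : ∀ i : Fin P.k, ZVPartition (H.induce ((P.Vs i : Finset β) : Set β)))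
      (hQ : ∀ i, IsZVLineGraph (Q i))
      (hroot : ∀ i : Fin P.k, ∃ h : P.root i ∈ ((P.Vs i : Finset β) : Set β),
          (⟨P.root i, h⟩ : ((P.Vs i : Finset β) : Set β)) ∈ (Q i).Z ∧
          ∀ z ∈ (Q i).Z, (Q i).ord ⟨P.root i, h⟩ ≤ (Q i).ord z)
      (hballroot : ∀ i, IsIntervalIn P.ord P.Z (ball H (P.root i) 1 ∩ (P.Z : Set β))) :
      IsZVLineGraph P

/-- `F` is the mechanism `F*` determined by the ZV-ordered partition `P` and the
mechanisms `Fi` on the induced subgraphs: if all (at least one) ballots belong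
to a common `Vᵢ`, return `Fᵢ` applied to the ballots; otherwise return the
leftmost Pareto optimal location in `Z`. -/
def IsFStar {α : Type} (G : SimpleGraph α) (P : ZVPartition G)
    (Fi : ∀ i : Fin P.k, List ((P.Vs i : Finset α) : Set α) → ((P.Vs i : Finset α) : Set α))
    (F : List α → α) : Prop :=
  (∀ (x : List α) (i : Fin P.k), x ≠ [] →
      ∀ h : ∀ a ∈ x, a ∈ ((P.Vs i : Finset α) : Set α),
      F x = ↑(Fi i (x.pmap (fun a ha => ⟨a, ha⟩) h))) ∧
  (∀ x : List α, (¬ ∃ i : Fin P.k, x ≠ [] ∧ ∀ a ∈ x, a ∈ P.Vs i) →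
      F x ∈ PO G x ∧ F x ∈ P.Z ∧ ∀ w ∈ P.Z, w ∈ PO G x → P.ord (F x) ≤ P.ord w)

/-- `F` is the mechanism obtained by applying the definition of `F*` recursively
to a ZV-line graph structure on `(H, P)`: at each level the partition satisfies
the ZV-line graph conditions, the mechanisms of the `Vᵢ`-subgraphs are themselves
recursively obtained in this way, and `F` satisfies the defining clauses of `F*`. -/
inductive IsRecFStar : {β : Type} → (H : SimpleGraph β) → (P : ZVPartition H) → (List β → β) → Prop
  | mk {β : Type} (H : SimpleGraph β) (P : ZVPartition H) (F : List β → β)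
      (hb : ∀ z ∈ P.Z, IsIntervalIn P.ord P.Z (ball H z 1 ∩ (P.Z : Set β)))
      (Q : ∀ i : Fin P.k, ZVPartition (H.induce ((P.Vs i : Finset β) : Set β)))
      (Fi : ∀ i : Fin P.k, List ((P.Vs i : Finset β) : Set β) → ((P.Vs i : Finset β) : Set β))
      (hrec : ∀ i, IsRecFStar (H.induce ((P.Vs i : Finset β) : Set β)) (Q i) (Fi i))
      (hroot : ∀ i : Fin P.k, ∃ h : P.root i ∈ ((P.Vs i : Finset β) : Set β),
          (⟨P.root i, h⟩ : ((P.Vs i : Finset β) : Set β)) ∈ (Q i).Z ∧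
          ∀ z ∈ (Q i).Z, (Q i).ord ⟨P.root i, h⟩ ≤ (Q i).ord z)
      (hballroot : ∀ i, IsIntervalIn P.ord P.Z (ball H (P.root i) 1 ∩ (P.Z : Set β)))
      (hF : IsFStar H P Fi F) :
      IsRecFStar H P F

section WalkDistance

variable {α : Type} {G : SimpleGraph α}

lemma dist_eq_add_of_forall_mem_support (hc : G.Connected) {u v w : α}
    (h : ∀ p : G.Walk u v, w ∈ p.support) : G.dist u v = G.dist u w + G.dist w v := by
  obtain ⟨p, hp⟩ := hc.exists_walk_length_eq_dist u v
  have h1 := SimpleGraph.dist_le (p.takeUntil w (h p))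
  have h2 := SimpleGraph.dist_le (p.dropUntil w (h p))
  have h3 := congrArg SimpleGraph.Walk.length (p.take_spec (h p))
  rw [SimpleGraph.Walk.length_append] at h3
  have h4 := hc.dist_triangle (u := u) (v := w) (w := v)
  omega

lemma exists_adj_dist_add_one (hc : G.Connected) {u v : α} (h : u ≠ v) :
    ∃ w, G.Adj u w ∧ G.dist w v + 1 = G.dist u v := by
  obtain ⟨p, hp⟩ := hc.exists_walk_length_eq_dist u v
  cases p with
  | nil => exact absurd rfl h
  | @cons _ w _ hadj q =>
    refine ⟨w, hadj, ?_⟩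
    have h1 := SimpleGraph.dist_le q
    have h2 := hc.dist_triangle (u := u) (v := w) (w := v)
    have h3 := SimpleGraph.dist_eq_one_iff_adj.2 hadj
    simp only [SimpleGraph.Walk.length_cons] at hp
    omega

lemma dist_induce_of_geodesics_mem (hc : G.Connected) {s : Set α} (u v : s)
    (h : ∀ w, G.dist u w + G.dist w v = G.dist (u : α) v → w ∈ s)
    (hs : (G.induce s).Connected) : (G.induce s).dist u v = G.dist (u : α) v := by
  apply le_antisymm
  · obtain ⟨p, hp⟩ := hc.exists_walk_length_eq_dist (u : α) v
    have hmem : ∀ w ∈ p.support, w ∈ s := by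
      intro w hw
      apply h
      have h1 := SimpleGraph.dist_le (p.takeUntil w hw)
      have h2 := SimpleGraph.dist_le (p.dropUntil w hw)
      have h3 := congrArg SimpleGraph.Walk.length (p.take_spec hw)
      rw [SimpleGraph.Walk.length_append] at h3
      have h4 := hc.dist_triangle (u := (u : α)) (v := w) (w := v)
      omega
    have h1 := SimpleGraph.dist_le (p.induce s hmem)
    have h2 := congrArg SimpleGraph.Walk.length (SimpleGraph.Walk.map_induce p hmem)
    rw [SimpleGraph.Walk.length_map] at h2
    exact h1.trans (h2.trans hp).le
  · obtain ⟨p, hp⟩ := hs.exists_walk_length_eq_dist u v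
    have h1 := SimpleGraph.dist_le (p.map (SimpleGraph.Embedding.induce s).toHom)
    rw [SimpleGraph.Walk.length_map, hp] at h1
    exact h1

end WalkDistance

section Pareto

variable {α : Type} {G : SimpleGraph α}

/-- Every location is weakly dominated by a Pareto optimal one. -/
lemma exists_mem_PO_forall_dist_le (G : SimpleGraph α) (x : List α) (v : α) :
    ∃ c ∈ PO G x, ∀ a ∈ x, G.dist a c ≤ G.dist a v := by
  induction hn : (x.map fun a => G.dist a v).sum using Nat.strong_induction_on generalizing v with
  | _ n ih =>
    by_cases hv : v ∈ PO G x
    · exact ⟨v, hv, fun _ _ => le_rfl⟩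
    · obtain ⟨u, hu, hu'⟩ := not_not.1 hv
      have hlt : (x.map fun a => G.dist a u).sum < n := by
        rw [← hn]
        exact List.sum_lt_sum _ _ hu hu'
      obtain ⟨c, hc, hle⟩ := ih _ hlt u rfl
      exact ⟨c, hc, fun a ha => (hle a ha).trans (hu a ha)⟩

lemma PO_congr_mem {x y : List α} (h : ∀ a, a ∈ x ↔ a ∈ y) : PO G x = PO G y := by
  simp only [PO, Dominates, h]

lemma mem_PO_of_mem (hc : G.Connected) {x : List α} {v : α} (hv : v ∈ x) : v ∈ PO G x := by
  rintro ⟨u, hu, a, ha, hs⟩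
  have h1 := hu v hv
  simp only [wPref, SimpleGraph.dist_self, nonpos_iff_eq_zero, hc.dist_eq_zero_iff] at h1
  subst h1
  exact lt_irrefl _ hs

lemma mem_profileMinus {n : ℕ} {x : Fin n → α} {C : Finset (Fin n)} {a : α} :
    a ∈ profileMinus x C ↔ ∃ i, i ∉ C ∧ x i = a := by
  simp [profileMinus]

lemma profileMinus_comp {β : Type} {n : ℕ} (f : α → β) (x : Fin n → α) (C : Finset (Fin n)) :
    profileMinus (f ∘ x) C = (profileMinus x C).map f := by
  simp [profileMinus]

/-- If a coalition weakly gains, and one of its members strictly, by moving away from a Pareto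
optimal location, then some agent outside the coalition strictly loses. -/
lemma exists_notMem_dist_lt {n : ℕ} {x : Fin n → α} {C : Finset (Fin n)} {a b : α}
    (ha : a ∈ PO G (List.ofFn x)) (hw : ∀ i ∈ C, wPref G (x i) b a)
    (hs : ∃ i ∈ C, sPref G (x i) b a) : ∃ j, j ∉ C ∧ G.dist (x j) a < G.dist (x j) b := by
  by_contra! h
  refine ha ⟨b, ?_, ?_⟩
  · intro v hv
    obtain ⟨j, rfl⟩ := (List.mem_ofFn' _ _).1 hv
    by_cases hj : j ∈ C
    exacts [hw j hj, h j hj]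
  · obtain ⟨i, _, hi⟩ := hs
    exact ⟨x i, (List.mem_ofFn' _ _).2 ⟨i, rfl⟩, hi⟩

end Pareto

namespace ZVPartition

variable {α : Type} {G : SimpleGraph α} (P : ZVPartition G)

lemma dist_eq_add_root {i : Fin P.k} {u v : α} (hu : u ∈ P.Vs i) (hv : v ∉ P.Vs i) :
    G.dist u v = G.dist u (P.root i) + G.dist (P.root i) v :=
  dist_eq_add_of_forall_mem_support P.hconn fun p => (P.separation i u hu v hv p).1

lemma dist_eq_add_root' {i : Fin P.k} {u v : α} (hu : u ∈ P.Vs i) (hv : v ∉ P.Vs i) :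
    G.dist v u = G.dist v (P.root i) + G.dist (P.root i) u := by
  rw [G.dist_comm, P.dist_eq_add_root hu hv, G.dist_comm, G.dist_comm (v := v), add_comm]

lemma dist_root_pos {i : Fin P.k} {v : α} (hv : v ∉ P.Vs i) : 0 < G.dist (P.root i) v :=
  P.hconn.pos_dist_of_ne fun h => hv (h ▸ P.root_mem i)

lemma eq_root_of_mem_Z {i : Fin P.k} {z : α} (hz : z ∈ P.Z) (hi : z ∈ P.Vs i) :
    z = P.root i := by
  refine P.root_unique i z hi fun w _ => ?_
  have h : distToSet G z P.Z ≤ G.dist z z := Nat.sInf_le ⟨z, hz, rfl⟩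
  rw [SimpleGraph.dist_self] at h
  omega

/-- From a root outside `Z`, every geodesic leaving its part steps into `Z`. -/
lemma exists_mem_Z_adj_root {i : Fin P.k} {v : α} (hr : P.root i ∉ P.Z) (hv : v ∉ P.Vs i) :
    ∃ z ∈ P.Z, G.dist (P.root i) z = 1 ∧ G.dist z v + 1 = G.dist (P.root i) v := by
  obtain ⟨w, hadj, hw⟩ := exists_adj_dist_add_one P.hconn
    (fun h => hv (h ▸ P.root_mem i) : P.root i ≠ v)
  have hwi : w ∉ P.Vs i := by
    intro h
    have := P.dist_eq_add_root h hv
    omega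
  obtain ⟨-, z, hz, hz'⟩ := P.separation i _ (P.root_mem i) w hwi (.cons hadj .nil)
  simp only [SimpleGraph.Walk.support_cons, SimpleGraph.Walk.support_nil, List.mem_cons,
    List.not_mem_nil, or_false] at hz'
  rcases hz' with rfl | rfl
  · exact absurd hz hr
  · exact ⟨z, hz, SimpleGraph.dist_eq_one_iff_adj.2 hadj, hw⟩

lemma dist_induce (i : Fin P.k) (hs : (G.induce (P.Vs i : Set α)).Connected)
    (u v : (P.Vs i : Set α)) :
    (G.induce (P.Vs i : Set α)).dist u v = G.dist (u : α) v := by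
  refine dist_induce_of_geodesics_mem P.hconn u v (fun w hw => ?_) hs
  by_contra hwi
  have hwi' : w ∉ P.Vs i := hwi
  have h1 := P.dist_eq_add_root u.2 hwi'
  have h2 := P.dist_eq_add_root' v.2 hwi'
  have h3 := P.dist_root_pos hwi'
  have h4 := P.hconn.dist_triangle (u := (u : α)) (v := P.root i) (w := v)
  omega

/-- All balls meet `Z` in intervals, provided those of radius one around `Z` and the roots do. -/
lemma dist_le_of_between
    (hb : ∀ z ∈ P.Z, IsIntervalIn P.ord P.Z (ball G z 1 ∩ (P.Z : Set α)))
    (hr : ∀ i, IsIntervalIn P.ord P.Z (ball G (P.root i) 1 ∩ (P.Z : Set α)))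
    (m : ℕ) {v a b c : α} (ha : a ∈ P.Z) (hbZ : b ∈ P.Z) (hc : c ∈ P.Z)
    (hac : P.ord a ≤ P.ord c) (hcb : P.ord c ≤ P.ord b)
    (hva : G.dist v a ≤ m) (hvb : G.dist v b ≤ m) : G.dist v c ≤ m := by
  induction m using Nat.strong_induction_on generalizing v a b c with
  | _ m ih =>
  rcases Nat.eq_zero_or_pos m with rfl | hm
  · have h1 := P.hconn.dist_eq_zero_iff.1 (Nat.le_zero.1 hva)
    have h2 := P.hconn.dist_eq_zero_iff.1 (Nat.le_zero.1 hvb)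
    subst h1 h2
    rw [P.ord_inj hc ha (le_antisymm hcb hac)]
    exact hva
  by_cases hvZ : v ∈ P.Z
  · rcases Nat.lt_or_ge 1 m with hm1 | hm1
    · have key : ∀ e ∈ P.Z, G.dist v e ≤ m →
          (P.ord e ≤ P.ord c ∧ P.ord c ≤ P.ord v ∨ P.ord v ≤ P.ord c ∧ P.ord c ≤ P.ord e) →
          G.dist v c ≤ m := by
        intro e he hve hbtw
        by_cases hne : v = e
        · subst hne
          have : P.ord c = P.ord v := by
            rcases hbtw with h | h <;> exact le_antisymm (by tauto) (by tauto)
          rw [P.ord_inj hc hvZ this]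
          exact hve
        obtain ⟨w, hadj, hw⟩ := exists_adj_dist_add_one P.hconn hne
        have hvw := SimpleGraph.dist_eq_one_iff_adj.2 hadj
        have hwv : G.dist w v = 1 := by rw [G.dist_comm, hvw]
        have htri := P.hconn.dist_triangle (u := v) (v := w) (w := c)
        have hwe : G.dist w e ≤ m - 1 := by omega
        have hwc : G.dist v c ≤ 1 ∨ G.dist w c ≤ m - 1 := by
          by_cases hwZ : w ∈ P.Z
          · have hww : G.dist w w ≤ m - 1 := by simp
            rcases hbtw with ⟨h1, h2⟩ | ⟨h1, h2⟩
            · rcases le_total (P.ord w) (P.ord c) with h | h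
              · exact .inl ((hb v hvZ).2 w ⟨hvw.le, hwZ⟩ v ⟨by simp [ball], hvZ⟩ c hc h h2).1
              · exact .inr (ih (m - 1) (by omega) he hwZ hc h1 h hwe hww)
            · rcases le_total (P.ord w) (P.ord c) with h | h
              · exact .inr (ih (m - 1) (by omega) hwZ he hc h h2 hww hwe)
              · exact .inl ((hb v hvZ).2 v ⟨by simp [ball], hvZ⟩ w ⟨hvw.le, hwZ⟩ c hc h1 h).1
          · have hwv' : G.dist w v ≤ m - 1 := by omega
            rcases hbtw with ⟨h1, h2⟩ | ⟨h1, h2⟩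
            · exact .inr (ih (m - 1) (by omega) he hvZ hc h1 h2 hwe hwv')
            · exact .inr (ih (m - 1) (by omega) hvZ he hc h1 h2 hwv' hwe)
        omega
      rcases le_total (P.ord c) (P.ord v) with h | h
      · exact key a ha hva (.inl ⟨hac, h⟩)
      · exact key b hbZ hvb (.inr ⟨h, hcb⟩)
    · have hm1' : m = 1 := by omega
      subst hm1'
      exact ((hb v hvZ).2 a ⟨hva, ha⟩ b ⟨hvb, hbZ⟩ c hc hac hcb).1
  · obtain ⟨i, hi⟩ := (P.cover v).resolve_left hvZ
    have root_dist : ∀ z ∈ P.Z, G.dist v z = G.dist v (P.root i) + G.dist (P.root i) z := by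
      intro z hz
      by_cases hzi : z ∈ P.Vs i
      · rw [P.eq_root_of_mem_Z hz hzi]; simp
      · exact P.dist_eq_add_root hi hzi
    by_cases hvr : v = P.root i
    · subst hvr
      have hout : ∀ z ∈ P.Z, z ∉ P.Vs i := fun z hz hzi =>
        hvZ (P.eq_root_of_mem_Z hz hzi ▸ hz)
      obtain ⟨w, hw, hvw, hwa⟩ := P.exists_mem_Z_adj_root hvZ (hout a ha)
      obtain ⟨w', hw', hvw', hwb⟩ := P.exists_mem_Z_adj_root hvZ (hout b hbZ)
      have htri := P.hconn.dist_triangle (u := P.root i) (v := w) (w := c)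
      have htri' := P.hconn.dist_triangle (u := P.root i) (v := w') (w := c)
      rcases le_total (P.ord c) (P.ord w) with h | h
      · have := ih (m - 1) (by omega) (v := w) ha hw hc hac h (by omega) (by simp)
        omega
      rcases le_total (P.ord w') (P.ord c) with h' | h'
      · have := ih (m - 1) (by omega) (v := w') hw' hbZ hc h' hcb (by simp) (by omega)
        omega
      · have : G.dist (P.root i) c ≤ 1 :=
          ((hr i).2 w ⟨hvw.le, hw⟩ w' ⟨hvw'.le, hw'⟩ c hc h h').1
        omega
    · have hpos := P.hconn.pos_dist_of_ne hvr
      have h1 := root_dist a ha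
      have h2 := root_dist b hbZ
      have h3 := root_dist c hc
      have := ih (m - G.dist v (P.root i)) (by omega) (v := P.root i) ha hbZ hc hac hcb
        (by omega) (by omega)
      omega

/-- If the ballots are not confined to one part, then every agent has a Pareto optimal location
among its favourite ones in `Z`. -/
lemma exists_mem_PO_forall_Z_dist_le {x : List α}
    (hx : ¬ ∃ i : Fin P.k, x ≠ [] ∧ ∀ a ∈ x, a ∈ P.Vs i) {v : α} (hv : v ∈ x) :
    ∃ p ∈ P.Z, p ∈ PO G x ∧ ∀ z ∈ P.Z, G.dist v p ≤ G.dist v z := by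
  by_cases hvZ : v ∈ P.Z
  · exact ⟨v, hvZ, mem_PO_of_mem P.hconn hv, by simp⟩
  obtain ⟨i, hi⟩ := (P.cover v).resolve_left hvZ
  obtain ⟨y, hy, hyi⟩ : ∃ y ∈ x, y ∉ P.Vs i := by
    by_contra! h
    exact hx ⟨i, List.ne_nil_of_mem hv, h⟩
  by_cases hr : P.root i ∈ P.Z
  · obtain ⟨c, hc, hle⟩ := exists_mem_PO_forall_dist_le G x (P.root i)
    have hcr : c = P.root i := by
      have hyc := hle y hy
      have hvc := hle v hv
      by_cases hci : c ∈ P.Vs i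
      · have := P.dist_eq_add_root' hci hyi
        exact (P.hconn.dist_eq_zero_iff.1 (by omega : G.dist (P.root i) c = 0)).symm
      · have h1 := P.dist_eq_add_root hi hci
        have h2 := P.dist_root_pos hci
        omega
    refine ⟨P.root i, hr, hcr ▸ hc, fun z hz => ?_⟩
    by_cases hzi : z ∈ P.Vs i
    · rw [P.eq_root_of_mem_Z hz hzi]
    · rw [P.dist_eq_add_root hi hzi]; omega
  · have hout : ∀ z ∈ P.Z, z ∉ P.Vs i := fun z hz hzi =>
      hr (P.eq_root_of_mem_Z hz hzi ▸ hz)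
    obtain ⟨z, hz, hrz, hzy⟩ := P.exists_mem_Z_adj_root hr hyi
    obtain ⟨c, hc, hle⟩ := exists_mem_PO_forall_dist_le G x z
    have hyc := hle y hy
    have hvc := hle v hv
    rw [G.dist_comm (u := y) (v := z)] at hyc
    have hci : c ∉ P.Vs i := by
      intro hci
      have h1 := P.dist_eq_add_root' hci hyi
      rw [G.dist_comm (u := y) (v := P.root i)] at h1
      omega
    have hcZ : c ∈ P.Z := by
      have h1 := P.dist_eq_add_root hi hci
      have h2 := P.dist_eq_add_root hi (hout z hz)
      obtain ⟨w, hw, -, hwc⟩ := P.exists_mem_Z_adj_root hr hci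
      have h3 : w = c := P.hconn.dist_eq_zero_iff.1 (by omega)
      exact h3 ▸ hw
    refine ⟨c, hcZ, hc, fun w hw => ?_⟩
    have h1 := P.dist_eq_add_root hi (hout z hz)
    have h2 := P.dist_eq_add_root hi (hout w hw)
    have h3 := P.dist_root_pos (hout w hw)
    omega

/-- No agent prefers a location of `Z` to the left of the leftmost Pareto optimal one. -/
lemma dist_le_of_leftmost
    (hb : ∀ z ∈ P.Z, IsIntervalIn P.ord P.Z (ball G z 1 ∩ (P.Z : Set α)))
    (hr : ∀ i, IsIntervalIn P.ord P.Z (ball G (P.root i) 1 ∩ (P.Z : Set α)))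
    {x : List α} (hx : ¬ ∃ i : Fin P.k, x ≠ [] ∧ ∀ a ∈ x, a ∈ P.Vs i) {a b v : α}
    (ha : a ∈ P.Z) (hleft : ∀ w ∈ P.Z, w ∈ PO G x → P.ord a ≤ P.ord w)
    (hbZ : b ∈ P.Z) (hba : P.ord b ≤ P.ord a) (hv : v ∈ x) : G.dist v a ≤ G.dist v b := by
  obtain ⟨p, hp, hpo, hmin⟩ := P.exists_mem_PO_forall_Z_dist_le hx hv
  exact P.dist_le_of_between hb hr _ hbZ hp ha hba (hleft p hp hpo) le_rfl (hmin b hbZ)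

/-- Pareto optimality within a part implies Pareto optimality in the whole graph. -/
lemma map_val_mem_PO {i : Fin P.k} (hs : (G.induce (P.Vs i : Set α)).Connected)
    {x : List (P.Vs i : Set α)} {v : (P.Vs i : Set α)}
    (hv : v ∈ PO (G.induce (P.Vs i : Set α)) x) : (v : α) ∈ PO G (x.map Subtype.val) := by
  rintro ⟨u, hu, a, ha, hlt⟩
  obtain ⟨a, hax, rfl⟩ := List.mem_map.1 ha
  obtain ⟨u', hu'⟩ : ∃ u' : (P.Vs i : Set α),
      ∀ w : (P.Vs i : Set α), G.dist (w : α) u' ≤ G.dist (w : α) u := by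
    by_cases hui : u ∈ P.Vs i
    · exact ⟨⟨u, hui⟩, fun _ => le_rfl⟩
    · refine ⟨⟨P.root i, P.root_mem i⟩, fun w => ?_⟩
      rw [P.dist_eq_add_root w.2 hui]
      exact Nat.le_add_right _ _
  refine hv ⟨u', fun w hw => ?_, a, hax, ?_⟩
  · simp only [wPref, P.dist_induce i hs]
    exact (hu' w).trans (hu w (List.mem_map_of_mem hw))
  · simp only [sPref, P.dist_induce i hs]
    exact (hu' a).trans_lt hlt

end ZVPartition

lemma exists_map_val_eq {α : Type} {s : Set α} {x : List α} (h : ∀ a ∈ x, a ∈ s) :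
    ∃ y : List s, x = y.map Subtype.val :=
  ⟨x.pmap (fun a ha => ⟨a, ha⟩) h, by simp [List.map_pmap]⟩

namespace IsFStar

variable {α : Type} {G : SimpleGraph α} {P : ZVPartition G}
  {Fi : ∀ i : Fin P.k, List ((P.Vs i : Finset α) : Set α) → ((P.Vs i : Finset α) : Set α)}
  {F : List α → α}

lemma apply_map_val (hF : IsFStar G P Fi F) {i : Fin P.k} {y : List (P.Vs i : Set α)}
    (hy : y ≠ []) : F (y.map Subtype.val) = Fi i y := by
  rw [hF.1 (y.map Subtype.val) i (mt List.map_eq_nil_iff.1 hy) fun a ha => by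
    obtain ⟨b, -, rfl⟩ := List.mem_map.1 ha
    exact b.2, List.pmap_map]
  simp

lemma anonymous (hF : IsFStar G P Fi F) (hFi : ∀ i, Anonymous (Fi i)) : Anonymous F := by
  intro x y hxy
  by_cases hx : ∃ i : Fin P.k, x ≠ [] ∧ ∀ a ∈ x, a ∈ P.Vs i
  · obtain ⟨i, hne, hi⟩ := hx
    rw [hF.1 x i hne hi, hF.1 y i (fun h => hne (by subst h; simpa using hxy))
      fun a ha => hi a (hxy.mem_iff.2 ha)]
    exact congrArg _ (hFi i _ _ (hxy.pmap _))
  · have hy : ¬ ∃ i : Fin P.k, y ≠ [] ∧ ∀ a ∈ y, a ∈ P.Vs i := by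
      rintro ⟨i, hne, hi⟩
      exact hx ⟨i, fun h => hne (by subst h; simpa using hxy),
        fun a ha => hi a (hxy.mem_iff.1 ha)⟩
    obtain ⟨h1, h2, h3⟩ := hF.2 x hx
    obtain ⟨h1', h2', h3'⟩ := hF.2 y hy
    have hPO : PO G x = PO G y := PO_congr_mem fun _ => hxy.mem_iff
    exact P.ord_inj h2 h2' (le_antisymm (h3 _ h2' (hPO ▸ h1')) (h3' _ h2 (hPO ▸ h1)))

lemma paretoOptimal (hF : IsFStar G P Fi F)
    (hs : ∀ i, (G.induce (P.Vs i : Set α)).Connected)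
    (hFi : ∀ i, ParetoOptimal (G.induce (P.Vs i : Set α)) (Fi i)) : ParetoOptimal G F := by
  intro x
  by_cases hx : ∃ i : Fin P.k, x ≠ [] ∧ ∀ a ∈ x, a ∈ P.Vs i
  · obtain ⟨i, hne, hi⟩ := hx
    obtain ⟨y, rfl⟩ := exists_map_val_eq (s := (P.Vs i : Set α)) hi
    rw [hF.apply_map_val (mt List.map_eq_nil_iff.2 hne)]
    exact P.map_val_mem_PO (hs i) (hFi i y)
  · exact (hF.2 x hx).1

lemma apply_eq_leftmost (hF : IsFStar G P Fi F)
    (hFi : ∀ i, ∀ y : List (P.Vs i : Set α), ⟨P.root i, P.root_mem i⟩ ∈ y →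
      Fi i y = ⟨P.root i, P.root_mem i⟩)
    {z : α} (hz : z ∈ P.Z) (hleft : ∀ w ∈ P.Z, P.ord z ≤ P.ord w) {x : List α} (hzx : z ∈ x) :
    F x = z := by
  by_cases hx : ∃ i : Fin P.k, x ≠ [] ∧ ∀ a ∈ x, a ∈ P.Vs i
  · obtain ⟨i, hne, hi⟩ := hx
    obtain ⟨y, rfl⟩ := exists_map_val_eq (s := (P.Vs i : Set α)) hi
    have hzr := P.eq_root_of_mem_Z hz (hi z hzx)
    subst hzr
    rw [hF.apply_map_val (mt List.map_eq_nil_iff.2 hne), hFi i y]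
    obtain ⟨b, hby, hb⟩ := List.mem_map.1 hzx
    rwa [← Subtype.ext (a1 := b) (a2 := ⟨P.root i, P.root_mem i⟩) hb]
  · obtain ⟨-, h2, h3⟩ := hF.2 x hx
    exact P.ord_inj h2 hz
      (le_antisymm (h3 z hz (mem_PO_of_mem P.hconn hzx)) (hleft _ h2))

lemma gmr (hF : IsFStar G P Fi F)
    (hb : ∀ z ∈ P.Z, IsIntervalIn P.ord P.Z (ball G z 1 ∩ (P.Z : Set α)))
    (hr : ∀ i, IsIntervalIn P.ord P.Z (ball G (P.root i) 1 ∩ (P.Z : Set α)))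
    (hs : ∀ i, (G.induce (P.Vs i : Set α)).Connected)
    (hPO : ∀ i, ParetoOptimal (G.induce (P.Vs i : Set α)) (Fi i))
    (hroot : ∀ i, ∀ y : List (P.Vs i : Set α), ⟨P.root i, P.root_mem i⟩ ∈ y →
      Fi i y = ⟨P.root i, P.root_mem i⟩)
    (hGMR : ∀ i, GMR (G.induce (P.Vs i : Set α)) (Fi i)) : GMR G F := by
  rintro ⟨n, x, C, A, hw, hst⟩
  obtain ⟨j, hjC, hj⟩ := exists_notMem_dist_lt (hF.paretoOptimal hs hPO (List.ofFn x)) hw hst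
  obtain ⟨k, hkC, hk⟩ := hst
  have hjx : x j ∈ List.ofFn x := (List.mem_ofFn' _ _).2 ⟨j, rfl⟩
  have hjy : x j ∈ A ++ profileMinus x C :=
    List.mem_append_right _ (mem_profileMinus.2 ⟨j, hjC, rfl⟩)
  have hkx : x k ∈ List.ofFn x := (List.mem_ofFn' _ _).2 ⟨k, rfl⟩
  simp only [wPref, sPref] at hw hk
  by_cases hx : ∃ i : Fin P.k, List.ofFn x ≠ [] ∧ ∀ a ∈ List.ofFn x, a ∈ P.Vs i
  · obtain ⟨i, hne, hi⟩ := hx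
    obtain ⟨x', rfl⟩ : ∃ x' : Fin n → (P.Vs i : Set α), x = Subtype.val ∘ x' :=
      ⟨fun l => ⟨x l, hi _ ((List.mem_ofFn' _ _).2 ⟨l, rfl⟩)⟩, rfl⟩
    have hne' : List.ofFn x' ≠ [] := by
      rw [← List.map_ofFn] at hne
      simpa using hne
    have hFx : F (List.ofFn (Subtype.val ∘ x')) = Fi i (List.ofFn x') := by
      rw [← List.map_ofFn, hF.apply_map_val hne']
    rw [hFx] at hw hk hj
    suffices h : ∃ B : List (P.Vs i : Set α), ∀ l,
        G.dist (x' l : α) (Fi i (B ++ profileMinus x' C)) ≤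
          G.dist (x' l : α) (F (A ++ profileMinus (Subtype.val ∘ x') C)) by
      obtain ⟨B, hB⟩ := h
      refine hGMR i ⟨n, x', C, B, fun l hl => ?_, k, hkC, ?_⟩
      · simp only [wPref, P.dist_induce i (hs i)]
        exact (hB l).trans (hw l hl)
      · simp only [sPref, P.dist_induce i (hs i)]
        exact (hB k).trans_lt hk
    by_cases hA : ∀ a ∈ A, a ∈ (P.Vs i : Set α)
    · obtain ⟨B, rfl⟩ := exists_map_val_eq hA
      refine ⟨B, fun l => ?_⟩
      rw [profileMinus_comp] at hjy ⊢
      rw [← List.map_append] at hjy ⊢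
      rw [hF.apply_map_val (fun h => by simp [h] at hjy)]
    · have hb' : F (A ++ profileMinus (Subtype.val ∘ x') C) ∈ P.Z := by
        refine (hF.2 _ ?_).2.1
        rintro ⟨i', -, hi'⟩
        by_cases hii : i' = i
        · subst hii
          exact hA fun a ha => hi' a (List.mem_append_left _ ha)
        · exact Finset.disjoint_left.1 (P.Vs_disjoint i' i hii) (hi' _ hjy) (x' j).2
      refine ⟨[⟨P.root i, P.root_mem i⟩], fun l => ?_⟩
      rw [hroot i _ (by simp)]
      generalize F (A ++ profileMinus (Subtype.val ∘ x') C) = b at hb'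
      by_cases hbi : b ∈ P.Vs i
      · rw [P.eq_root_of_mem_Z hb' hbi]
      · rw [P.dist_eq_add_root (x' l).2 hbi]
        exact Nat.le_add_right _ _
  · obtain ⟨-, haZ, hleft⟩ := hF.2 _ hx
    by_cases hy : ∃ i : Fin P.k, A ++ profileMinus x C ≠ [] ∧
        ∀ a ∈ A ++ profileMinus x C, a ∈ P.Vs i
    · obtain ⟨i, hne, hi⟩ := hy
      have hbi : F (A ++ profileMinus x C) ∈ P.Vs i := by
        rw [hF.1 _ i hne hi]
        exact Subtype.coe_prop _
      generalize F (A ++ profileMinus x C) = b at *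
      generalize F (List.ofFn x) = a at *
      obtain ⟨u, hu⟩ : ∃ u, x u ∉ P.Vs i := by
        by_contra! h
        refine hx ⟨i, List.ne_nil_of_mem hjx, fun c hc => ?_⟩
        obtain ⟨l, rfl⟩ := (List.mem_ofFn' _ _).1 hc
        exact h l
      have huC : u ∈ C := by
        by_contra h
        exact hu (hi _ (List.mem_append_right _ (mem_profileMinus.2 ⟨u, h, rfl⟩)))
      have h1 := hw u huC
      have h2 := P.dist_eq_add_root' hbi hu
      have h3 := P.hconn.dist_triangle (u := x u) (v := P.root i) (w := a)
      have h4 := P.hconn.dist_triangle (u := x j) (v := P.root i) (w := b)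
      have h5 : G.dist (x j) a = G.dist (x j) (P.root i) + G.dist (P.root i) a := by
        by_cases hai : a ∈ P.Vs i
        · rw [P.eq_root_of_mem_Z haZ hai]; simp
        · exact P.dist_eq_add_root (hi _ hjy) hai
      omega
    · obtain ⟨-, hbZ, hleft'⟩ := hF.2 _ hy
      rcases le_total (P.ord (F (List.ofFn x))) (P.ord (F (A ++ profileMinus x C))) with h | h
      · have := P.dist_le_of_leftmost hb hr hy hbZ hleft' haZ h hjy
        omega
      · have := P.dist_le_of_leftmost hb hr hx haZ hleft hbZ h hkx
        omega

end IsFStar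


lemma IsRecFStar.properties {α : Type} {G : SimpleGraph α} {P : ZVPartition G} {F : List α → α}
    (h : IsRecFStar G P F) :
    (Anonymous F ∧ ParetoOptimal G F ∧ GMR G F) ∧
      ∀ z ∈ P.Z, (∀ w ∈ P.Z, P.ord z ≤ P.ord w) → ∀ x : List α, z ∈ x → F x = z := by
  induction h with
  | mk H P F hb Q Fi hrec hroot hballroot hF ih =>
    have hs i := (Q i).hconn
    have hleft : ∀ i, ∀ y : List (P.Vs i : Set _), ⟨P.root i, P.root_mem i⟩ ∈ y →
        Fi i y = ⟨P.root i, P.root_mem i⟩ := by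
      intro i y hy
      obtain ⟨_, hmem, hle⟩ := hroot i
      exact (ih i).2 _ hmem hle y hy
    exact ⟨⟨hF.anonymous fun i => (ih i).1.1,
      hF.paretoOptimal hs fun i => (ih i).1.2.1,
      hF.gmr hb hballroot hs (fun i => (ih i).1.2.1) hleft fun i => (ih i).1.2.2⟩,
      fun z hz hzl x hzx => hF.apply_eq_leftmost hleft hz hzl hzx⟩

/-- If `G` is a finite connected ZV-line graph w.r.t. the
ZV-ordered partition `P` and `F` is the mechanism `F*` obtained by applying the
definition of `F*` recursively to `G` and its subgraphs, then `F` is anonymous,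
Pareto optimal, and group-manipulation-resistant. -/
theorem fstar_anonymous_paretoOptimal_gmr
    {α : Type} [Fintype α] (G : SimpleGraph α) (P : ZVPartition G) (F : List α → α)
    (hZV : IsZVLineGraph P) (hF : IsRecFStar G P F) :
    Anonymous F ∧ ParetoOptimal G F ∧ GMR G F := by
  exact hF.properties.1
end
end

section
/- Let G = (𝒱, E) be a finite connected simple graph with a ZV-ordered partition ⟨Z, V_1, …, V_k⟩, and let x be a location profile whose ballots do not all belong to one common set V_i. Then PO(x) ∩ Z ≠ ∅. -/
/- Common framework: finite connected simple graphs, shortest-path distance,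
   profiles as lists of vertices, mechanisms as functions `List α → α`,
   anonymity, Pareto optimality, and group-manipulation-resistance. -/

open Classical

noncomputable section

/-- A geodesic leaving `Vᵢ` passes through the root of `Vᵢ` and through `Z`. -/
theorem ZVPartition.exists_geodesic_through {α : Type} {G : SimpleGraph α} (P : ZVPartition G)
    {i : Fin P.k} {u v : α} (hu : u ∈ P.Vs i) (hv : v ∉ P.Vs i) :
    G.dist u (P.root i) + G.dist (P.root i) v = G.dist u v ∧
      ∃ z ∈ P.Z, G.dist u z + G.dist z v = G.dist u v := by
  obtain ⟨p, hp⟩ := P.hconn.exists_walk_length_eq_dist u v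
  have key : ∀ w ∈ p.support, G.dist u w + G.dist w v = G.dist u v := by
    intro w hw
    have hlen := congrArg SimpleGraph.Walk.length (p.take_spec hw)
    rw [SimpleGraph.Walk.length_append] at hlen
    have h₁ := SimpleGraph.dist_le (p.takeUntil w hw)
    have h₂ := SimpleGraph.dist_le (p.dropUntil w hw)
    have h₃ := P.hconn.dist_triangle (u := u) (v := w) (w := v)
    omega
  obtain ⟨hr, z, hz, hzp⟩ := P.separation i u hu v hv p
  exact ⟨key _ hr, z, hz, key z hzp⟩

/-- The only possible common vertex of `Z` and `Vᵢ` is the root of `Vᵢ`. -/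
theorem ZVPartition.eq_root_of_mem {α : Type} {G : SimpleGraph α} (P : ZVPartition G)
    {i : Fin P.k} {z : α} (hz : z ∈ P.Z) (hi : z ∈ P.Vs i) : z = P.root i := by
  refine P.root_unique i z hi fun w _ => ?_
  have h : distToSet G z P.Z ≤ 0 := Nat.sInf_le ⟨z, hz, G.dist_self⟩
  omega

/-- A dominating location is strictly better in terms of total distance. -/
theorem Dominates.sum_dist_lt {α : Type} {G : SimpleGraph α} {x : List α} {u v : α}
    (h : Dominates G x u v) :
    (x.map fun a => G.dist a u).sum < (x.map fun a => G.dist a v).sum :=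
  List.sum_lt_sum _ _ h.1 h.2

/-- Let `G` be a finite connected graph with a ZV-ordered
partition `P`, and let `x` be a profile whose ballots do not all belong to one
common set `Vᵢ`. Then `PO(x) ∩ Z ≠ ∅`. -/
theorem pareto_in_Z_nonempty
    {α : Type} [Fintype α] (G : SimpleGraph α) (P : ZVPartition G)
    (x : List α) (hx : ¬ ∃ i : Fin P.k, ∀ a ∈ x, a ∈ P.Vs i) :
    (PO G x ∩ (P.Z : Set α)).Nonempty := by
  by_cases hZ : ∃ b ∈ x, b ∈ P.Z
  · obtain ⟨b, hb, hbZ⟩ := hZ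
    refine ⟨b, ?_, hbZ⟩
    rintro ⟨u, hle, a, -, hlt⟩
    have h := hle b hb
    simp only [wPref, SimpleGraph.dist_self, Nat.le_zero, P.hconn.dist_eq_zero_iff] at h
    subst h
    exact lt_irrefl _ hlt
  rcases x.eq_nil_or_concat' with rfl | ⟨l, b, hxl⟩
  · obtain ⟨z, hz⟩ := P.Z_nonempty
    exact ⟨z, by simp [PO, Dominates], hz⟩
  have hb : b ∈ x := by simp [hxl]
  clear hxl
  obtain ⟨i, hbi⟩ := (P.cover b).resolve_left fun h => hZ ⟨b, hb, h⟩
  obtain ⟨c, hc, hci⟩ : ∃ c ∈ x, c ∉ P.Vs i := by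
    by_contra! h
    exact hx ⟨i, h⟩
  -- Among the `Z`-vertices on geodesics from `b` to `c`, take one closest to `b`,
  -- breaking ties by total distance.
  obtain ⟨z₀, hz₀, hg₀⟩ := (P.exists_geodesic_through hbi hci).2
  let S := P.Z.filter fun z => G.dist b z + G.dist z c = G.dist b c
  obtain ⟨z, hzS, hmin⟩ := S.exists_min_image
    (fun z => toLex (G.dist b z, (x.map fun a => G.dist a z).sum))
    ⟨z₀, Finset.mem_filter.2 ⟨hz₀, hg₀⟩⟩
  obtain ⟨hz, hg⟩ := Finset.mem_filter.1 hzS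
  refine ⟨z, ?_, hz⟩
  rintro ⟨u, hu⟩
  have hub : G.dist b u ≤ G.dist b z := hu.1 b hb
  have huc : G.dist c u ≤ G.dist c z := hu.1 c hc
  rw [G.dist_comm (u := c), G.dist_comm (u := c)] at huc
  have tri := fun p q r : α => P.hconn.dist_triangle (u := p) (v := q) (w := r)
  have tbuc := tri b u c
  have hug : G.dist b u + G.dist u c = G.dist b c := by omega
  have hbu : G.dist b u = G.dist b z := by omega
  have huZ : u ∉ P.Z := by
    intro huZ
    have h := hmin u (Finset.mem_filter.2 ⟨huZ, hug⟩)
    have hs := hu.sum_dist_lt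
    rw [Prod.Lex.toLex_le_toLex] at h
    dsimp only at h
    omega
  obtain ⟨m, hum⟩ := (P.cover u).resolve_left huZ
  by_cases hbm : b ∈ P.Vs m
  · have him : i = m := by
      by_contra h
      exact Finset.disjoint_left.1 (P.Vs_disjoint i m h) hbi hbm
    subst him
    have hr := (P.exists_geodesic_through hum hci).1
    have hrz : G.dist b (P.root i) + G.dist (P.root i) z = G.dist b z := by
      by_cases hzi : z ∈ P.Vs i
      · simp [← P.eq_root_of_mem hz hzi]
      · exact (P.exists_geodesic_through hbi hzi).1
    have t₁ := tri b (P.root i) c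
    have hur : G.dist u (P.root i) = 0 := by omega
    have hrz' : G.dist (P.root i) z = 0 := by omega
    rw [P.hconn.dist_eq_zero_iff] at hur hrz'
    exact huZ (hur.trans hrz' ▸ hz)
  · obtain ⟨w, hw, hwg⟩ := (P.exists_geodesic_through hum hbm).2
    have hpos : 0 < G.dist u w := P.hconn.pos_dist_of_ne fun h => huZ (h ▸ hw)
    have t₁ := tri b w c
    have t₂ := tri w u c
    rw [G.dist_comm (u := u) (v := b), G.dist_comm (u := w) (v := b)] at hwg
    rw [G.dist_comm (u := w) (v := u)] at t₂
    have h := hmin w (Finset.mem_filter.2 ⟨hw, by omega⟩)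
    rw [Prod.Lex.toLex_le_toLex] at h
    dsimp only at h
    omega
end
end

section
/- Let G = (𝒱, E) be a finite connected simple graph with a ZV-ordered partition ⟨Z, V_1, …, V_k⟩, and let x be a location profile all of whose ballots belong to V_i for some fixed i. Then every agent strictly prefers R(V_i) over every location outside V_i; consequently PO(x) ⊆ V_i, and a location v ∈ V_i belongs to PO(x) if and only if v is Pareto optimal when only the locations of V_i are considered as alternatives. -/
/- Common framework: finite connected simple graphs, shortest-path distance,
   profiles as lists of vertices, mechanisms as functions `List α → α`,
   anonymity, Pareto optimality, and group-manipulation-resistance. -/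

open Classical

noncomputable section

/-- Every ballot of a part strictly prefers the root of that part over each location outside it. -/
theorem ZVPartition.sPref_root {α : Type} {G : SimpleGraph α} (P : ZVPartition G) {i : Fin P.k}
    {a u : α} (ha : a ∈ P.Vs i) (hu : u ∉ P.Vs i) : sPref G a (P.root i) u := by
  obtain ⟨p, hp⟩ := P.hconn.exists_walk_length_eq_dist a u
  have hr := (P.separation i a ha u hu p).1
  have hne : P.root i ≠ u := fun h => hu (h ▸ P.root_mem i)
  calc G.dist a (P.root i) ≤ (p.takeUntil _ hr).length := SimpleGraph.dist_le _
    _ < p.length := p.length_takeUntil_lt_length hr hne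
    _ = G.dist a u := hp

/-- Let `G` be a finite connected graph with a ZV-ordered
partition `P`, and let `x` be a nonempty profile all of whose ballots belong to
`Vᵢ` for a fixed `i`. Then every agent strictly prefers the root `R(Vᵢ)` over
every location outside `Vᵢ`; consequently `PO(x) ⊆ Vᵢ`, and a location `v ∈ Vᵢ`
is Pareto optimal iff it is Pareto optimal when only locations of `Vᵢ` are
considered as alternatives. -/
theorem pareto_subset_of_profile_in_Vi
    {α : Type} [Fintype α] (G : SimpleGraph α) (P : ZVPartition G)
    (i : Fin P.k) (x : List α) (hne : x ≠ []) (hx : ∀ a ∈ x, a ∈ P.Vs i) :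
    (∀ a ∈ x, ∀ u : α, u ∉ P.Vs i → sPref G a (P.root i) u) ∧
    PO G x ⊆ (P.Vs i : Set α) ∧
    (∀ v ∈ P.Vs i, (v ∈ PO G x ↔ ¬ ∃ u ∈ P.Vs i, Dominates G x u v)) := by
  have hroot : ∀ a ∈ x, ∀ u : α, u ∉ P.Vs i → sPref G a (P.root i) u :=
    fun a ha u hu => P.sPref_root (hx a ha) hu
  obtain ⟨b, hb⟩ := List.exists_mem_of_ne_nil x hne
  refine ⟨hroot, fun v hv => ?_, fun v _ => ⟨fun hv ⟨u, _, hu⟩ => hv ⟨u, hu⟩, ?_⟩⟩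
  · by_contra hvi
    exact hv ⟨P.root i, fun a ha => (hroot a ha v hvi).le, b, hb, hroot b hb v hvi⟩
  · rintro h ⟨u, hu⟩
    by_cases hui : u ∈ P.Vs i
    · exact h ⟨u, hui, hu⟩
    · have hlt : ∀ a ∈ x, sPref G a (P.root i) v :=
        fun a ha => (hroot a ha u hui).trans_le (hu.1 a ha)
      exact h ⟨P.root i, P.root_mem i, fun a ha => (hlt a ha).le, b, hb, hlt b hb⟩
end
end

section
/- Let G = (𝒱, E) be a finite tree and let r ∈ 𝒱 be a root. Then for every nonempty location profile x there is a unique Pareto optimal location minimizing the distance to r (namely the lowest common ancestor of the ballots with respect to the root r), and the mechanism F mapping each nonempty profile x to this location is anonymous, Pareto optimal, and group-manipulation-resistant. -/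
/- Common framework: finite connected simple graphs, shortest-path distance,
   profiles as lists of vertices, mechanisms as functions `List α → α`,
   anonymity, Pareto optimality, and group-manipulation-resistance. -/

open Classical

noncomputable section

/-- `w` lies on a geodesic from `u` to `v`. -/
def OnGeodesic {α : Type} (G : SimpleGraph α) (u w v : α) : Prop :=
  G.dist u w + G.dist w v = G.dist u v

/-- In a tree, a vertex on the path from `r` to `a` lies on the path from `r` to `v` or on the
path from `a` to `v`. -/
theorem OnGeodesic.or_of_isTree {α : Type} {G : SimpleGraph α} (hT : G.IsTree) {r w a : α}
    (h : OnGeodesic G r w a) (v : α) : OnGeodesic G r w v ∨ OnGeodesic G a w v := by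
  obtain ⟨p, hp⟩ := hT.connected.exists_walk_length_eq_dist r w
  obtain ⟨q, hq⟩ := hT.connected.exists_walk_length_eq_dist w a
  obtain ⟨s, hs⟩ := hT.connected.exists_walk_length_eq_dist r v
  obtain ⟨t, ht⟩ := hT.connected.exists_walk_length_eq_dist a v
  have hpq : (p.append q).IsPath := by
    apply SimpleGraph.Walk.isPath_of_length_eq_dist
    rw [SimpleGraph.Walk.length_append, hp, hq, h]
  have heq : p.append q = (s.append t.reverse).bypass :=
    congrArg Subtype.val ((hT.isAcyclic.subsingleton_path r a).elim ⟨_, hpq⟩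
      ⟨_, (s.append t.reverse).bypass_isPath⟩)
  have hw : w ∈ (s.append t.reverse).support := by
    apply (s.append t.reverse).support_bypass_subset_support
    rw [← heq]
    simp
  have onGeodesic_of_mem : ∀ {u x : α} (c : G.Walk u x), c.length = G.dist u x → w ∈ c.support →
      OnGeodesic G u w x := by
    intro u x c hc hwc
    obtain ⟨c₁, c₂, rfl⟩ := SimpleGraph.Walk.mem_support_iff_exists_append.mp hwc
    rw [SimpleGraph.Walk.length_append] at hc
    have h₁ := SimpleGraph.dist_le c₁
    have h₂ := SimpleGraph.dist_le c₂
    have h₃ := hT.connected.dist_triangle (u := u) (v := w) (w := x)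
    unfold OnGeodesic
    omega
  rw [SimpleGraph.Walk.mem_support_append_iff] at hw
  rcases hw with hw | hw
  · exact Or.inl (onGeodesic_of_mem s hs hw)
  · exact Or.inr (onGeodesic_of_mem t ht (by simpa using hw))

/-- `w` is a common ancestor of the ballots in `x`, in the tree rooted at `r`. -/
def IsCommonAncestor {α : Type} (G : SimpleGraph α) (r : α) (x : List α) (w : α) : Prop :=
  ∀ a ∈ x, OnGeodesic G r w a

/-- A location that is not a descendant of the common ancestor `w` is worse than `w` for
everyone. -/
theorem IsCommonAncestor.dist_lt_of_not_onGeodesic {α : Type} {G : SimpleGraph α} (hT : G.IsTree)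
    {r w v : α} {x : List α} (hw : IsCommonAncestor G r x w) (hv : ¬ OnGeodesic G r w v) :
    ∀ a ∈ x, G.dist a w < G.dist a v := by
  intro a ha
  have h := ((hw a ha).or_of_isTree hT v).resolve_left hv
  have hne : w ≠ v := by
    rintro rfl
    exact hv (by simp [OnGeodesic])
  have hpos := hT.connected.pos_dist_of_ne hne
  unfold OnGeodesic at h
  omega

/-- Pareto optimal locations are descendants of every common ancestor. -/
theorem IsCommonAncestor.onGeodesic_of_mem_PO {α : Type} {G : SimpleGraph α} (hT : G.IsTree)
    {r w v : α} {x : List α} (hx : x ≠ []) (hw : IsCommonAncestor G r x w)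
    (hv : v ∈ PO G x) : OnGeodesic G r w v := by
  by_contra hn
  have hlt := hw.dist_lt_of_not_onGeodesic hT hn
  obtain ⟨a, ha⟩ := List.exists_mem_of_ne_nil x hx
  exact hv ⟨w, fun b hb => (hlt b hb).le, a, ha, hlt a ha⟩

/-- A deepest common ancestor is Pareto optimal. -/
theorem IsCommonAncestor.mem_PO_of_deepest {α : Type} {G : SimpleGraph α} (hT : G.IsTree)
    {r w : α} {x : List α} (hw : IsCommonAncestor G r x w)
    (hmax : ∀ v, IsCommonAncestor G r x v → G.dist r v ≤ G.dist r w) : w ∈ PO G x := by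
  rintro ⟨u, hle, b, hb, hlt⟩
  unfold wPref at hle
  unfold sPref at hlt
  have hru : OnGeodesic G r w u := by
    by_contra hn
    exact lt_asymm hlt (hw.dist_lt_of_not_onGeodesic hT hn b hb)
  have hne : w ≠ u := by
    rintro rfl
    exact lt_irrefl _ hlt
  obtain ⟨p, hp⟩ := hT.connected.exists_walk_length_eq_dist w u
  cases p with
  | nil => exact hne rfl
  | @cons _ c _ hadj q =>
    rw [SimpleGraph.Walk.length_cons] at hp
    have hq := SimpleGraph.dist_le q
    have hwc : G.dist w c = 1 := SimpleGraph.dist_eq_one_iff_adj.mpr hadj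
    have htri := hT.connected.dist_triangle (u := w) (v := c) (w := u)
    have htri' := hT.connected.dist_triangle (u := r) (v := c) (w := u)
    have htri'' := hT.connected.dist_triangle (u := r) (v := w) (w := c)
    unfold OnGeodesic at hru
    have hc : IsCommonAncestor G r x c := by
      intro a ha
      have hwcu : OnGeodesic G w c u := by
        unfold OnGeodesic
        omega
      have hra := hw a ha
      have h₁ := hT.connected.dist_triangle (u := r) (v := c) (w := a)
      rcases hwcu.or_of_isTree hT a with h | h
      · unfold OnGeodesic at h hra ⊢
        omega
      · have hne' := hT.dist_ne_of_adj a hadj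
        have hau := hle a ha
        simp only [G.dist_comm (u := a)] at hne' hau
        have hwa := hadj.symm.diff_dist_adj (u := a)
        simp only [G.dist_comm (u := a)] at hwa
        unfold OnGeodesic at h hra ⊢
        omega
    have := hmax c hc
    omega

/-- The lowest common ancestor is Pareto optimal, and lies between the root and every Pareto
optimal location. -/
theorem exists_lca {α : Type} [Fintype α] {G : SimpleGraph α} (hT : G.IsTree) (r : α)
    {x : List α} (hx : x ≠ []) :
    ∃ w, IsCommonAncestor G r x w ∧ w ∈ PO G x ∧ ∀ v ∈ PO G x, OnGeodesic G r w v := by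
  obtain ⟨w, hw, hmax⟩ := Set.exists_max_image {w | IsCommonAncestor G r x w} (G.dist r)
    (Set.toFinite _) ⟨r, fun a _ => by simp [OnGeodesic]⟩
  exact ⟨w, hw, IsCommonAncestor.mem_PO_of_deepest hT hw hmax,
    fun v hv => IsCommonAncestor.onGeodesic_of_mem_PO hT hx hw hv⟩

/-- A location between `r` and `v` that is no closer to `r` than `v` is `v` itself. -/
theorem OnGeodesic.eq_of_dist_le {α : Type} {G : SimpleGraph α} (hG : G.Connected) {r w v : α}
    (h : OnGeodesic G r w v) (hle : G.dist v r ≤ G.dist w r) : w = v := by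
  rw [G.dist_comm (u := v), G.dist_comm (u := w)] at hle
  unfold OnGeodesic at h
  exact hG.dist_eq_zero_iff.mp (by omega)

theorem existsUnique_closest_mem_PO {α : Type} [Fintype α] {G : SimpleGraph α} (hT : G.IsTree)
    (r : α) {x : List α} (hx : x ≠ []) :
    ∃! w : α, w ∈ PO G x ∧ ∀ v ∈ PO G x, G.dist w r ≤ G.dist v r := by
  obtain ⟨w, -, hPO, hbtw⟩ := exists_lca hT r hx
  refine ⟨w, ⟨hPO, fun v hv => ?_⟩, fun v hv => ?_⟩
  · have h := hbtw v hv
    rw [G.dist_comm (u := v), G.dist_comm (u := w)]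
    unfold OnGeodesic at h
    omega
  · exact ((hbtw v hv.1).eq_of_dist_le hT.connected (hv.2 w hPO)).symm

/-- A Pareto optimal location closest to the root is a common ancestor of the ballots. -/
theorem isCommonAncestor_of_closest {α : Type} [Fintype α] {G : SimpleGraph α} (hT : G.IsTree)
    {r w : α} {x : List α} (hx : x ≠ []) (hw : w ∈ PO G x)
    (hmin : ∀ v ∈ PO G x, G.dist w r ≤ G.dist v r) : IsCommonAncestor G r x w := by
  obtain ⟨u, hu, hPO, hbtw⟩ := exists_lca hT r hx
  obtain rfl := (hbtw w hw).eq_of_dist_le hT.connected (hmin u hPO)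
  exact hu

theorem PO_eq_of_perm {α : Type} (G : SimpleGraph α) {x y : List α} (h : x.Perm y) :
    PO G x = PO G y := by
  simp only [PO, Dominates, h.mem_iff]

theorem mem_profileMinus_s9 {α : Type} {n : ℕ} {x : Fin n → α} {C : Finset (Fin n)} {j : Fin n}
    (hj : j ∉ C) : x j ∈ profileMinus x C := by
  simp only [profileMinus, List.mem_map, List.mem_filter]
  exact ⟨j, ⟨List.mem_finRange j, by simpa using hj⟩, rfl⟩

/-- Let `G` be a finite tree with a root `r`. Then every
nonempty profile has a unique Pareto optimal location minimizing the distance to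
`r` (the lowest common ancestor of the ballots), and the mechanism returning
this location is anonymous, Pareto optimal, and group-manipulation-resistant. -/
theorem tree_lca_mechanism
    {α : Type} [Fintype α] (G : SimpleGraph α) (hT : G.IsTree) (r : α) :
    (∀ x : List α, x ≠ [] →
        ∃! w : α, w ∈ PO G x ∧ ∀ v ∈ PO G x, G.dist w r ≤ G.dist v r) ∧
    (∀ F : List α → α,
        (∀ x : List α, x ≠ [] →
            F x ∈ PO G x ∧ ∀ v ∈ PO G x, G.dist (F x) r ≤ G.dist v r) →
        Anonymous F ∧ ParetoOptimal G F ∧ GMR G F) := by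
  refine ⟨fun x hx => existsUnique_closest_mem_PO hT r hx, fun F hF => ⟨?_, ?_, ?_⟩⟩
  · intro x y hxy
    rcases eq_or_ne x [] with rfl | hx
    · rw [hxy.nil_eq]
    · have hy : y ≠ [] := fun h => hx (by simpa [h] using hxy)
      have hFy := hF y hy
      rw [← PO_eq_of_perm G hxy] at hFy
      exact (existsUnique_closest_mem_PO hT r hx).unique (hF x hx) hFy
  · intro x
    rcases eq_or_ne x [] with rfl | hx
    · rintro ⟨u, -, a, ha, -⟩
      simp at ha
    · exact (hF x hx).1
  · rintro ⟨n, x, C, A, hle, i, hi, hlt⟩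
    unfold wPref at hle
    unfold sPref at hlt
    have hmem : ∀ j, x j ∈ List.ofFn x := fun j => List.mem_ofFn.mpr ⟨j, rfl⟩
    have hx : List.ofFn x ≠ [] := List.ne_nil_of_mem (hmem i)
    obtain ⟨hPO, hmin⟩ := hF _ hx
    have hanc := isCommonAncestor_of_closest hT hx hPO hmin
    set w := F (List.ofFn x)
    set y := A ++ profileMinus x C
    have hbtw : OnGeodesic G r w (F y) := by
      by_contra hn
      exact lt_asymm hlt (hanc.dist_lt_of_not_onGeodesic hT hn (x i) (hmem i))
    refine hPO ⟨F y, fun a ha => ?_, x i, hmem i, hlt⟩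
    obtain ⟨j, rfl⟩ := List.mem_ofFn.mp ha
    by_cases hj : j ∈ C
    · exact hle j hj
    · have hjy : x j ∈ y := List.mem_append_right _ (mem_profileMinus_s9 hj)
      have hyne : y ≠ [] := List.ne_nil_of_mem hjy
      have h₁ := isCommonAncestor_of_closest hT hyne (hF y hyne).1 (hF y hyne).2 (x j) hjy
      have h₂ := hT.connected.dist_triangle (u := r) (v := w) (w := x j)
      unfold wPref
      rw [G.dist_comm (u := x j), G.dist_comm (u := x j)]
      unfold OnGeodesic at h₁ hbtw
      omega
end
end
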